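/- arXiv:0901.3833 — 2 statements merged into one kernel-verified Lean document; each statement's English description precedes it below -/
import Mathlib

section
/- Let p be an odd prime, G a finite p-group, and V a faithful 𝔽_p G-module such that no non-identity element of Ω₁(Z(G)) is quadratic on V. Suppose G has an abelian normal subgroup A ⊴ G such that the quotient G/A is also abelian. Then V is not an F-module. -/
open Polynomial

section Defs

variable (p : ℕ) {G V : Type*} [Group G] [AddCommGroup V] [Module (ZMod p) V]

/-- The fixed-point subspace `C_V(H)` of a subgroup `H ≤ G`. -/
def fixedPts (ρ : Representation (ZMod p) G V) (H : Subgroup G) :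
    Submodule (ZMod p) V where
  carrier := {v | ∀ h ∈ H, ρ h v = v}
  add_mem' := by
    intro a b ha hb h hh
    simp [map_add, ha h hh, hb h hh]
  zero_mem' := by
    intro h hh
    simp
  smul_mem' := by
    intro c v hv h hh
    simp [map_smul, hv h hh]

/-- `E` is an elementary abelian `p`-subgroup. -/
def IsElemAbelian (E : Subgroup G) : Prop :=
  (∀ x ∈ E, x ^ p = 1) ∧ ∀ x ∈ E, ∀ y ∈ E, x * y = y * x

/-- `E` is an offender of `G` on `V`. -/
def IsOffender (ρ : Representation (ZMod p) G V) (E : Subgroup G) : Prop :=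
  E ≠ ⊥ ∧ IsElemAbelian p E ∧
    Nat.card V ≤ Nat.card E * Nat.card (fixedPts p ρ E)

/-- `j_H(V) = |H|·|C_V(H)|/|V|`. -/
noncomputable def jval (ρ : Representation (ZMod p) G V) (H : Subgroup G) : ℚ :=
  ((Nat.card H : ℚ) * (Nat.card (fixedPts p ρ H) : ℚ)) / (Nat.card V : ℚ)

/-- A non-identity element `g` is quadratic on `V`: `(g-1)² = 0` on `V`. -/
def IsQuadElt (ρ : Representation (ZMod p) G V) (g : G) : Prop :=
  g ≠ 1 ∧ (ρ g - 1) ^ 2 = 0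

/-- `[V,E,E] = 0`. -/
def IsQuadSubgroup (ρ : Representation (ZMod p) G V) (E : Subgroup G) : Prop :=
  ∀ e ∈ E, ∀ f ∈ E, (ρ e - 1) * (ρ f - 1) = 0

/-- The set `𝒫(G,V)` of best offenders. -/
def bestOffenders (ρ : Representation (ZMod p) G V) : Set (Subgroup G) :=
  {E | E ≠ ⊥ ∧ IsElemAbelian p E ∧
    ∀ F : Subgroup G, F ≤ E → jval p ρ F ≤ jval p ρ E}

end Defs

section Offenders

variable {p : ℕ} {G V : Type*} [Group G] [AddCommGroup V] [Module (ZMod p) V]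

/-- `|H|·|C_V(H)|`, the numerator of `jval`. -/
noncomputable def fixMeasure (ρ : Representation (ZMod p) G V) (H : Subgroup G) : ℕ :=
  Nat.card H * Nat.card (fixedPts p ρ H)

/-- The elements of `T` that fix every vector of `S`. -/
def pointwiseFixer (ρ : Representation (ZMod p) G V) (T : Subgroup G) (S : Set V) :
    Subgroup G where
  carrier := {t | t ∈ T ∧ ∀ w ∈ S, ρ t w = w}
  mul_mem' := by
    rintro a b ⟨ha, ha'⟩ ⟨hb, hb'⟩
    exact ⟨mul_mem ha hb, fun w hw => by simp [hb' w hw, ha' w hw]⟩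
  one_mem' := ⟨one_mem T, fun w _ => by simp⟩
  inv_mem' := by
    rintro a ⟨ha, ha'⟩
    refine ⟨inv_mem ha, fun w hw => ?_⟩
    nth_rewrite 1 [← ha' w hw]
    simp

variable (ρ : Representation (ZMod p) G V)

lemma fixedPts_antitone {H K : Subgroup G} (h : H ≤ K) : fixedPts p ρ K ≤ fixedPts p ρ H :=
  fun _ hv x hx => hv x (h hx)

lemma fixedPts_sup (H K : Subgroup G) :
    fixedPts p ρ (H ⊔ K) = fixedPts p ρ H ⊓ fixedPts p ρ K := by
  refine le_antisymm (le_inf (fixedPts_antitone ρ le_sup_left) (fixedPts_antitone ρ le_sup_right)) ?_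
  rintro v ⟨hH, hK⟩
  have : H ⊔ K ≤ pointwiseFixer ρ ⊤ {v} := by
    refine sup_le (fun x hx => ⟨trivial, ?_⟩) (fun x hx => ⟨trivial, ?_⟩)
    · rintro w rfl; exact hH x hx
    · rintro w rfl; exact hK x hx
  exact fun x hx => (this hx).2 v rfl

lemma Subgroup.card_mul_card_le [Finite G] (H K : Subgroup G) :
    Nat.card H * Nat.card K ≤ Nat.card ↥(H ⊔ K) * Nat.card ↥(H ⊓ K) := by
  have h1 : Nat.card ↥(H ⊓ K) * H.relIndex K = Nat.card K := by
    rw [← inf_relIndex_right, ← relIndex_bot_left, ← relIndex_bot_left]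
    exact relIndex_mul_relIndex _ _ _ bot_le inf_le_right
  have h2 : Nat.card H * H.relIndex (H ⊔ K) = Nat.card ↥(H ⊔ K) := by
    rw [← relIndex_bot_left, ← relIndex_bot_left]
    exact relIndex_mul_relIndex _ _ _ bot_le le_sup_left
  have h3 : H.relIndex K ≤ H.relIndex (H ⊔ K) :=
    relIndex_le_of_le_right le_sup_right fun h => by simp [h, Nat.card_pos.ne] at h2
  calc Nat.card H * Nat.card K = Nat.card H * H.relIndex K * Nat.card ↥(H ⊓ K) := by
        rw [← h1]; ring
    _ ≤ Nat.card H * H.relIndex (H ⊔ K) * Nat.card ↥(H ⊓ K) := by gcongr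
    _ = _ := by rw [h2]

lemma Submodule.card_sup_mul_card_inf {K W : Type*} [Field K] [Finite K] [AddCommGroup W]
    [Module K W] [Finite W] (s t : Submodule K W) :
    Nat.card ↥(s ⊔ t) * Nat.card ↥(s ⊓ t) = Nat.card s * Nat.card t := by
  rw [Module.natCard_eq_pow_finrank (K := K) (V := ↥(s ⊔ t)),
    Module.natCard_eq_pow_finrank (K := K) (V := ↥(s ⊓ t)),
    Module.natCard_eq_pow_finrank (K := K) (V := s),
    Module.natCard_eq_pow_finrank (K := K) (V := t), ← pow_add, ← pow_add,
    Submodule.finrank_sup_add_finrank_inf_eq]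

lemma fixMeasure_mul_le [Fact p.Prime] [Finite G] [Finite V] (H K : Subgroup G) :
    fixMeasure ρ H * fixMeasure ρ K ≤ fixMeasure ρ (H ⊔ K) *
      (Nat.card ↥(H ⊓ K) * Nat.card ↥(fixedPts p ρ H ⊔ fixedPts p ρ K)) := by
  have h1 := Subgroup.card_mul_card_le H K
  have h2 := Submodule.card_sup_mul_card_inf (fixedPts p ρ H) (fixedPts p ρ K)
  unfold fixMeasure
  rw [fixedPts_sup]
  calc _ = (Nat.card H * Nat.card K) *
        (Nat.card (fixedPts p ρ H) * Nat.card (fixedPts p ρ K)) := by ring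
    _ ≤ (Nat.card ↥(H ⊔ K) * Nat.card ↥(H ⊓ K)) *
        (Nat.card (fixedPts p ρ H) * Nat.card (fixedPts p ρ K)) := by gcongr
    _ = _ := by rw [← h2]; ring

lemma sup_fixedPts_le (H K : Subgroup G) :
    fixedPts p ρ H ⊔ fixedPts p ρ K ≤ fixedPts p ρ (H ⊓ K) :=
  sup_le (fixedPts_antitone ρ inf_le_left) (fixedPts_antitone ρ inf_le_right)

lemma fixMeasure_pos [Finite G] [Finite V] (H : Subgroup G) : 0 < fixMeasure ρ H :=
  Nat.mul_pos Nat.card_pos Nat.card_pos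

lemma fixMeasure_bot : fixMeasure ρ ⊥ = Nat.card V := by
  have : fixedPts p ρ ⊥ = ⊤ := by
    refine eq_top_iff.2 fun v _ x hx => ?_
    rw [Subgroup.mem_bot.1 hx]; simp
  simp [fixMeasure, this]

lemma fixMeasure_le_map_conj [Finite V] (g : G) (H : Subgroup G) :
    fixMeasure ρ H ≤ fixMeasure ρ (H.map (MulAut.conj g).toMonoidHom) := by
  refine Nat.mul_le_mul (Nat.card_congr (H.equivMapOfInjective _
    (MulAut.conj g).injective).toEquiv).le ?_
  refine Nat.card_le_card_of_injective
    (fun v => ⟨ρ g v.1, ?_⟩) ?_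
  · rintro _ ⟨h, hh, rfl⟩
    have := v.2 h hh
    simp [this]
  · rintro ⟨v, hv⟩ ⟨w, hw⟩ h
    have := congrArg (ρ g⁻¹) (Subtype.ext_iff.1 h)
    simpa using this

/-- The maximizers of `fixMeasure` among the subgroups of `B`. -/
def maximizers (B : Subgroup G) : Set (Subgroup G) :=
  {H | H ≤ B ∧ ∀ K ≤ B, fixMeasure ρ K ≤ fixMeasure ρ H}

variable {ρ}

lemma maximizers_sup_inf [Fact p.Prime] [Finite G] [Finite V] {B H K : Subgroup G}
    (hH : H ∈ maximizers ρ B) (hK : K ∈ maximizers ρ B) :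
    H ⊔ K ∈ maximizers ρ B ∧ H ⊓ K ∈ maximizers ρ B ∧
      fixedPts p ρ (H ⊓ K) = fixedPts p ρ H ⊔ fixedPts p ρ K := by
  have hmul := fixMeasure_mul_le ρ H K
  have hs := hH.2 _ (sup_le hH.1 hK.1)
  have hi := hK.2 _ (inf_le_left.trans hH.1 : H ⊓ K ≤ B)
  have hle : Nat.card ↥(fixedPts p ρ H ⊔ fixedPts p ρ K) ≤ Nat.card (fixedPts p ρ (H ⊓ K)) :=
    Nat.card_le_card_of_injective _ (Submodule.inclusion_injective (sup_fixedPts_le ρ H K))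
  set x := Nat.card ↥(H ⊓ K) * Nat.card ↥(fixedPts p ρ H ⊔ fixedPts p ρ K) with hx
  have hxi : x ≤ fixMeasure ρ (H ⊓ K) := Nat.mul_le_mul le_rfl hle
  have hHpos := fixMeasure_pos ρ H
  have hKpos := fixMeasure_pos ρ K
  have hse : fixMeasure ρ H ≤ fixMeasure ρ (H ⊔ K) := by
    by_contra! hc
    nlinarith
  have hxe : fixMeasure ρ K ≤ x := by
    by_contra! hc
    nlinarith
  refine ⟨⟨sup_le hH.1 hK.1, fun L hL => (hH.2 L hL).trans hse⟩,
    ⟨inf_le_left.trans hH.1, fun L hL => (hK.2 L hL).trans (hxe.trans hxi)⟩, ?_⟩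
  have hcard : Nat.card (fixedPts p ρ (H ⊓ K)) ≤
      Nat.card ↥(fixedPts p ρ H ⊔ fixedPts p ρ K) :=
    Nat.le_of_mul_le_mul_left (hi.trans hxe) Nat.card_pos
  have := Set.eq_of_subset_of_ncard_le (s := (↑(fixedPts p ρ H ⊔ fixedPts p ρ K) : Set V))
    (sup_fixedPts_le ρ H K) hcard (Set.toFinite _)
  exact (SetLike.coe_injective this).symm

variable (ρ)

/-- Thompson's replacement inequality for a single vector. -/
lemma fixMeasure_le_pointwiseFixer [Finite G] [Finite V] {T : Subgroup G}
    (hT : ∀ a ∈ T, ∀ b ∈ T, a * b = b * a) (v : V) (W : Submodule (ZMod p) V)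
    (hTW : fixedPts p ρ T ≤ W) (hvW : ∀ t ∈ T, ρ t v - v ∈ W) :
    fixMeasure ρ T ≤ Nat.card (pointwiseFixer ρ T {w | ∃ s ∈ T, w = ρ s v - v}) *
      Nat.card ↥(W ⊓ fixedPts p ρ (pointwiseFixer ρ T {w | ∃ s ∈ T, w = ρ s v - v})) := by
  set F := pointwiseFixer ρ T {w | ∃ s ∈ T, w = ρ s v - v} with hF
  have hFT : F ≤ T := fun x hx => hx.1
  let q : T → T ⧸ F.subgroupOf T := QuotientGroup.mk
  let r : T → T := fun t => (q t).out
  have hr : ∀ t, (r t)⁻¹ * t ∈ F.subgroupOf T := fun t =>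
    QuotientGroup.eq.1 (QuotientGroup.out_eq' (q t))
  rw [fixMeasure, ← Nat.card_prod, ← Nat.card_prod]
  refine Nat.card_le_card_of_injective (fun x => (⟨((r x.1)⁻¹ * x.1 : T), hr x.1⟩,
    ⟨(ρ (r x.1) v - v) + x.2, ?_, ?_⟩)) ?_
  · exact add_mem (hvW _ (r x.1).2) (hTW x.2.2)
  · exact add_mem (fun f hf => hf.2 _ ⟨_, (r x.1).2, rfl⟩) (fixedPts_antitone ρ hFT x.2.2)
  · rintro ⟨t, c⟩ ⟨t', c'⟩ h
    have h1 : ((r t)⁻¹ * t : T) = (r t')⁻¹ * t' :=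
      Subtype.ext (congrArg (fun z => (z.1 : G)) h)
    have h2 : ρ (r t) v - v + c.1 = ρ (r t') v - v + c'.1 := congrArg (fun z => (z.2 : V)) h
    have hfix : ρ (r t) v - ρ (r t') v ∈ fixedPts p ρ T := by
      have : ρ (r t) v - ρ (r t') v = c'.1 - c.1 := by
        rw [sub_eq_sub_iff_add_eq_add]
        rw [sub_add_eq_add_sub, sub_add_eq_add_sub, sub_left_inj] at h2
        rw [h2, add_comm]
      rw [this]
      exact sub_mem c'.2 c.2
    have hmem : (r t')⁻¹ * r t ∈ F.subgroupOf T := by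
      refine ⟨((r t')⁻¹ * r t).2, ?_⟩
      rintro _ ⟨s, hs, rfl⟩
      have e1 : ρ (s * (r t' : G)⁻¹) (ρ (r t) v - ρ (r t') v) =
          ρ ((r t' : G)⁻¹) (ρ (r t) v - ρ (r t') v) := by
        rw [hfix _ (mul_mem hs (inv_mem (r t').2)), hfix _ (inv_mem (r t').2)]
      have e2 : (((r t')⁻¹ * r t : T) : G) * s = s * (r t' : G)⁻¹ * r t := by
        rw [hT _ ((r t')⁻¹ * r t).2 s hs]; simp [mul_assoc]
      have e3 : s * (r t' : G)⁻¹ * r t' = s := by group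
      have e4 : ((r t' : G)⁻¹ * r t : G) = (((r t')⁻¹ * r t : T) : G) := by simp
      rw [map_sub, map_sub, ← Module.End.mul_apply, ← Module.End.mul_apply,
        ← Module.End.mul_apply, ← Module.End.mul_apply, ← map_mul, ← map_mul, ← map_mul,
        ← map_mul, e3, ← e2, e4, inv_mul_cancel, map_one, Module.End.one_apply,
        map_mul, Module.End.mul_apply] at e1
      rw [map_sub]
      rw [sub_eq_sub_iff_add_eq_add] at e1 ⊢
      exact e1.trans (add_comm _ _)
    have hq : q t' = q t := by
      have := QuotientGroup.eq.2 hmem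
      rwa [show ((r t' : T) : T ⧸ F.subgroupOf T) = q t' from QuotientGroup.out_eq' _,
        show ((r t : T) : T ⧸ F.subgroupOf T) = q t from QuotientGroup.out_eq' _] at this
    have hrr : r t' = r t := by simp only [r, hq]
    rw [hrr] at h1 h2
    have h3 : t = t' := Subtype.ext (by simpa using h1)
    have h4 : c = c' := Subtype.ext (add_left_cancel h2)
    rw [h3, h4]

end Offenders

section Unipotent

variable {p : ℕ} {G V : Type*} [Group G] [AddCommGroup V] [Module (ZMod p) V]

/-- `[V,T]` together with `C_V(T)`. -/
def commutatorSupFixed (ρ : Representation (ZMod p) G V) (T : Subgroup G) :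
    Submodule (ZMod p) V :=
  fixedPts p ρ T ⊔ Submodule.span (ZMod p) {w | ∃ s ∈ T, ∃ v, w = ρ s v - v}

lemma commutatorSupFixed_ne_top [Fact p.Prime] [Finite G] [Finite V] (hG : IsPGroup p G)
    (ρ : Representation (ZMod p) G V) {T : Subgroup G} (hT : fixedPts p ρ T ≠ ⊤) :
    commutatorSupFixed ρ T ≠ ⊤ := by
  let D := (fixedPts p ρ T).dualAnnihilator
  let _ : MulAction T D :=
    { smul := fun t f => ⟨f.1 ∘ₗ ρ (t : G)⁻¹, (Submodule.mem_dualAnnihilator _).2 fun w hw => by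
        rw [LinearMap.comp_apply, hw _ (inv_mem t.2)]
        exact (Submodule.mem_dualAnnihilator _).1 f.2 w hw⟩
      one_smul := fun f => Subtype.ext <| LinearMap.ext fun w => by
        change f.1 (ρ ((1 : T) : G)⁻¹ w) = f.1 w
        simp
      mul_smul := fun s t f => Subtype.ext <| LinearMap.ext fun w => by
        change f.1 (ρ ((s * t : T) : G)⁻¹ w) = f.1 (ρ (t : G)⁻¹ (ρ (s : G)⁻¹ w))
        simp }
  have hsmul : ∀ (t : T) (f : D) (w : V), (t • f).1 w = f.1 (ρ (t : G)⁻¹ w) := fun _ _ _ => rfl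
  have : Finite (Module.Dual (ZMod p) V) := Module.finite_of_finite (ZMod p)
  have hD : Nontrivial D := by
    obtain ⟨f, hf, hfle⟩ := Submodule.exists_le_ker_of_lt_top _ (lt_top_iff_ne_top.2 hT)
    exact ⟨⟨f, (Submodule.mem_dualAnnihilator _).2 fun w hw => hfle hw⟩, 0,
      fun h => hf (congrArg Subtype.val h)⟩
  have hdvd : p ∣ Nat.card D := by
    rw [Module.natCard_eq_pow_finrank (K := ZMod p), Nat.card_zmod]
    exact dvd_pow_self _ Module.finrank_pos.ne'
  obtain ⟨f, hf, hf0⟩ := (hG.to_subgroup T).exists_fixed_point_of_prime_dvd_card_of_fixed_point D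
    hdvd (a := 0) fun t => Subtype.ext <| LinearMap.ext fun w => hsmul t 0 w
  intro htop
  refine hf0 (Subtype.ext (LinearMap.ext fun w => ?_))
  have hle : commutatorSupFixed ρ T ≤ LinearMap.ker f.1 := by
    refine sup_le (fun w hw => (Submodule.mem_dualAnnihilator _).1 f.2 w hw)
      (Submodule.span_le.2 ?_)
    rintro _ ⟨s, hs, v, rfl⟩
    have := hsmul (⟨s, hs⟩⁻¹ : T) f v
    rw [hf] at this
    simp only [InvMemClass.coe_inv, inv_inv] at this
    simp [← this]
  exact (hle (htop ▸ Submodule.mem_top : w ∈ _)).symm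

variable {ρ : Representation (ZMod p) G V}

/-- The greatest maximizer `T` of `fixMeasure` in an abelian subgroup contains a non-trivial
maximizer `F` with `[V,T,F] = 0`. -/
lemma exists_quadratic_maximizer [Fact p.Prime] [Finite G] [Finite V] (hG : IsPGroup p G)
    (hρ : Function.Injective ρ) {B H : Subgroup G} (hB : ∀ a ∈ B, ∀ b ∈ B, a * b = b * a)
    (hHB : H ≤ B) (hH : H ≠ ⊥) (hVH : Nat.card V ≤ fixMeasure ρ H) :
    ∃ T, IsGreatest (maximizers ρ B) T ∧ ∃ F ∈ maximizers ρ B, F ≠ ⊥ ∧ F ≤ T ∧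
      ∀ f ∈ F, ∀ t ∈ T, ∀ v, ρ f (ρ t v - v) = ρ t v - v := by
  obtain ⟨M, hMB, hM⟩ := Set.exists_max_image {K | K ≤ B} (fixMeasure ρ) (Set.toFinite _) ⟨H, hHB⟩
  obtain ⟨T, hT⟩ := (Set.toFinite (maximizers ρ B)).exists_maximal ⟨M, hMB, hM⟩
  have hgr : IsGreatest (maximizers ρ B) T :=
    ⟨hT.1, fun K hK => le_sup_right.trans (hT.2 (maximizers_sup_inf hT.1 hK).1 le_sup_left)⟩
  have hTbot : T ≠ ⊥ := by
    rintro rfl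
    refine hH (le_bot_iff.1 (hgr.2 ⟨hHB, fun K hK => (hT.1.2 K hK).trans ?_⟩))
    rwa [fixMeasure_bot]
  have hTfix : fixedPts p ρ T ≠ ⊤ := by
    refine fun h => hTbot ((Subgroup.eq_bot_iff_forall _).2 fun t ht => hρ ?_)
    ext v
    have hv : v ∈ fixedPts p ρ T := h ▸ Submodule.mem_top
    simpa using hv t ht
  set W := commutatorSupFixed ρ T with hW
  have hmemW : ∀ v, ∀ t ∈ T, ρ t v - v ∈ W := fun v t ht =>
    Submodule.mem_sup_right (Submodule.subset_span ⟨t, ht, v, rfl⟩)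
  obtain ⟨F, hF⟩ := (Set.toFinite {K ∈ maximizers ρ B | fixedPts p ρ K ≤ W}).exists_minimal
    ⟨T, hT.1, le_sup_left⟩
  have hleast : ∀ K ∈ maximizers ρ B, fixedPts p ρ K ≤ W → F ≤ K := fun K hK hKW =>
    (hF.2 ⟨(maximizers_sup_inf hF.1.1 hK).2.1,
      (maximizers_sup_inf hF.1.1 hK).2.2 ▸ sup_le hF.1.2 hKW⟩ inf_le_left).trans inf_le_right
  refine ⟨T, hgr, F, hF.1.1, ?_, hgr.2 hF.1.1, fun f hf t ht v => ?_⟩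
  · rintro rfl
    refine commutatorSupFixed_ne_top hG ρ hTfix (top_le_iff.1 (le_trans ?_ hF.1.2))
    intro v _ x hx
    rw [Subgroup.mem_bot.1 hx]; simp
  · set F' := pointwiseFixer ρ T {w | ∃ s ∈ T, w = ρ s v - v} with hF'
    have hF'T : F' ≤ T := fun x hx => hx.1
    have hineq := fixMeasure_le_pointwiseFixer ρ
      (fun a ha b hb => hB a (hT.1.1 ha) b (hT.1.1 hb)) v W le_sup_left (hmemW v)
    rw [← hF'] at hineq
    have hle : Nat.card ↥(W ⊓ fixedPts p ρ F') ≤ Nat.card (fixedPts p ρ F') :=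
      Nat.card_le_card_of_injective _ (Submodule.inclusion_injective inf_le_right)
    have hF'max := hT.1.2 F' (hF'T.trans hT.1.1)
    have hmax : F' ∈ maximizers ρ B := ⟨hF'T.trans hT.1.1, fun K hK =>
      (hT.1.2 K hK).trans (hineq.trans (Nat.mul_le_mul le_rfl hle))⟩
    have hcard : Nat.card (fixedPts p ρ F') ≤ Nat.card ↥(W ⊓ fixedPts p ρ F') :=
      Nat.le_of_mul_le_mul_left (hF'max.trans hineq) Nat.card_pos
    have heq : W ⊓ fixedPts p ρ F' = fixedPts p ρ F' := SetLike.coe_injective <|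
      Set.eq_of_subset_of_ncard_le inf_le_right hcard (Set.toFinite _)
    exact (hleast F' hmax (inf_eq_right.1 heq) hf).2 _ ⟨t, ht, rfl⟩

end Unipotent

section QuadraticElements

lemma sub_one_sq_eq_zero_of_mul_quadratic {R : Type*} [Ring R]
    (htwo : ∀ z : R, 2 * z = 0 → z = 0) {x y y' : R} (hy : y' * y = 1) (hxy : x * y = y * x)
    (hx : (x - 1) ^ 2 = 0) (h : (x * y - 1) ^ 2 = 0) (h' : (x * y' - 1) ^ 2 = 0) :
    (y - 1) ^ 2 = 0 := by
  have hdiff : (x - y) ^ 2 = 0 := by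
    have e : x - y = (x * y' - 1) * y := by rw [sub_mul, mul_assoc, hy]; simp
    have c : y * (x * y' - 1) * y = (x * y' - 1) * y * y := by
      rw [mul_assoc, ← e, sub_mul, mul_sub, ← hxy]
    rw [sq, e, mul_assoc, ← mul_assoc y, c, ← mul_assoc, ← mul_assoc, ← sq, h', zero_mul, zero_mul]
  have hc : Commute x y := hxy
  have h1 : x * x = 2 * x - 1 := by
    rw [← sub_eq_zero, ← hx]; noncomm_ring
  have h2 : x * x * (y * y) = 2 * (x * y) - 1 := by
    rw [← sub_eq_zero, ← h, sq, sub_mul, mul_sub, hc.mul_mul_mul_comm]; noncomm_ring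
  have h3 : x * x = 2 * (x * y) - y * y := by
    rw [← sub_eq_zero, ← hdiff, sq, sub_mul, mul_sub, mul_sub, ← hxy]; noncomm_ring
  have h4 : x * (y - 1) ^ 2 = 0 := by
    apply htwo
    have e1 : 2 * (x * (y * y)) = y * y + 2 * (x * y) - 1 := by
      rw [h1] at h2
      have : (2 * x - 1) * (y * y) = 2 * (x * (y * y)) - y * y := by noncomm_ring
      rw [this, sub_eq_iff_eq_add] at h2
      rw [h2]; abel
    have e2 : 2 * x = 2 * (x * y) - y * y + 1 := by rw [← h3, h1]; abel
    have e3 : 2 * (x * (y - 1) ^ 2) = 2 * (x * (y * y)) - 4 * (x * y) + 2 * x := by noncomm_ring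
    rw [e3, e1, e2]; noncomm_ring
  have h5 : (2 - x) * x = 1 := by
    rw [sub_mul, h1]; abel
  calc (y - 1) ^ 2 = (2 - x) * (x * (y - 1) ^ 2) := by rw [← mul_assoc, h5, one_mul]
    _ = 0 := by rw [h4, mul_zero]

lemma Subgroup.exists_mem_center_of_normal {p : ℕ} [Fact p.Prime] {G : Type*} [Group G]
    [Finite G] (hG : IsPGroup p G) (N : Subgroup G) [N.Normal] (hN : N ≠ ⊥) :
    ∃ z ∈ N, z ∈ Subgroup.center G ∧ z ≠ 1 := by
  have : Nontrivial N := N.nontrivial_iff_ne_bot.2 hN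
  obtain ⟨n, hn0, hn⟩ := (hG.to_subgroup N).nontrivial_iff_card.1 inferInstance
  obtain ⟨z, hz, hz1⟩ :=
    (hG.of_equiv ConjAct.toConjAct).exists_fixed_point_of_prime_dvd_card_of_fixed_point N
      (hn ▸ dvd_pow_self _ hn0.ne') (a := 1) fun g => smul_one g
  refine ⟨z, z.2, Subgroup.mem_center_iff.2 fun g => ?_, fun h => hz1 (Subtype.ext h.symm)⟩
  have := congrArg Subtype.val (hz (ConjAct.toConjAct g))
  rw [ConjAct.Subgroup.val_conj_smul, ConjAct.smul_def, ConjAct.ofConjAct_toConjAct] at this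
  rwa [← mul_inv_eq_iff_eq_mul]

variable {p : ℕ} {G V : Type*} [Group G] [AddCommGroup V] [Module (ZMod p) V]
  {ρ : Representation (ZMod p) G V}

lemma pow_eq_one_of_quadratic (hρ : Function.Injective ρ) {g : G} (hg : (ρ g - 1) ^ 2 = 0) :
    g ^ p = 1 := by
  have key : ∀ n : ℕ, ρ g ^ n = 1 + n • (ρ g - 1) := by
    intro n
    induction n with
    | zero => simp
    | succ n ih =>
      have e : ρ g = 1 + (ρ g - 1) := by abel
      rw [pow_succ, ih]
      nth_rewrite 2 [e]
      rw [mul_add, mul_one, add_mul, one_mul, smul_mul_assoc, ← sq, hg, smul_zero, add_zero,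
        add_assoc, succ_nsmul]
  apply hρ
  rw [map_pow, key, map_one, add_eq_left]
  ext v
  rw [LinearMap.smul_apply, ← Nat.cast_smul_eq_nsmul (ZMod p)]
  simp

lemma quadratic_conj {x : G} (hx : (ρ x - 1) ^ 2 = 0) (g : G) :
    (ρ (g * x * g⁻¹) - 1) ^ 2 = 0 := by
  have hg : ρ g⁻¹ * ρ g = 1 := by rw [← map_mul]; simp
  have hg' : ρ g * ρ g⁻¹ = 1 := by rw [← map_mul]; simp
  have e : ρ (g * x * g⁻¹) - 1 = ρ g * (ρ x - 1) * ρ g⁻¹ := by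
    rw [mul_sub, sub_mul, mul_one, hg', map_mul, map_mul]
  calc _ = ρ g * (ρ x - 1) * (ρ g⁻¹ * ρ g) * (ρ x - 1) * ρ g⁻¹ := by
        rw [e, sq]; simp only [mul_assoc]
    _ = ρ g * (ρ x - 1) ^ 2 * ρ g⁻¹ := by rw [hg, sq]; simp only [mul_assoc, one_mul]
    _ = 0 := by rw [hx, mul_zero, zero_mul]

/-- If `b * x * b⁻¹ * x⁻¹` is central and `x` is quadratic, then so is this commutator. -/
lemma quadratic_of_central_commutator [Fact p.Prime] (hodd : Odd p) {x b z : G}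
    (hx : (ρ x - 1) ^ 2 = 0) (hz : z ∈ Subgroup.center G) (hzb : z = b * x * b⁻¹ * x⁻¹) :
    (ρ z - 1) ^ 2 = 0 := by
  have hc := Subgroup.mem_center_iff.1 hz
  have h1 : x * z = b * x * b⁻¹ := by rw [hc, hzb]; group
  have h2 : x * z⁻¹ = b⁻¹ * x * b⁻¹⁻¹ := by
    rw [mul_inv_eq_iff_eq_mul, hc, ← mul_assoc, ← mul_assoc, ← hc b⁻¹, hzb]; group
  have htwo : (2 : ZMod p) ≠ 0 := by
    intro h
    have := (ZMod.natCast_eq_zero_iff 2 p).1 (by exact_mod_cast h)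
    have hp2 := (Nat.prime_dvd_prime_iff_eq Fact.out Nat.prime_two).1 this
    rw [hp2] at hodd
    exact absurd hodd (by decide)
  refine sub_one_sq_eq_zero_of_mul_quadratic (x := ρ x) (y' := ρ z⁻¹) (fun f hf => ?_)
    (by rw [← map_mul]; simp) (by rw [← map_mul, ← map_mul, hc]) hx
    (by rw [← map_mul, h1]; exact quadratic_conj hx b)
    (by rw [← map_mul, h2]; exact quadratic_conj hx b⁻¹)
  have : (2 : ZMod p) • f = 0 := by rw [two_smul, ← two_mul, hf]
  exact (smul_eq_zero.1 this).resolve_left htwo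

/-- The commutators `[a, x]`, `a ∈ A`, for an abelian normal subgroup `A`. -/
def commutatorSubgroup (A : Subgroup G) [A.Normal] (hA : ∀ a ∈ A, ∀ b ∈ A, a * b = b * a)
    (x : G) : Subgroup G where
  carrier := {y | ∃ a ∈ A, y = a * x * a⁻¹ * x⁻¹}
  one_mem' := ⟨1, one_mem A, by simp⟩
  mul_mem' := by
    rintro _ _ ⟨a, ha, rfl⟩ ⟨b, hb, rfl⟩
    refine ⟨a * b, mul_mem ha hb, ?_⟩
    have hac : x * a⁻¹ * x⁻¹ ∈ A := ‹A.Normal›.conj_mem _ (inv_mem ha) x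
    have hbc : x * b⁻¹ * x⁻¹ ∈ A := ‹A.Normal›.conj_mem _ (inv_mem hb) x
    calc _ = a * ((x * a⁻¹ * x⁻¹) * b) * (x * b⁻¹ * x⁻¹) := by group
      _ = a * b * ((x * a⁻¹ * x⁻¹) * (x * b⁻¹ * x⁻¹)) := by rw [hA _ hac b hb]; group
      _ = _ := by rw [hA _ hac _ hbc]; group
  inv_mem' := by
    rintro _ ⟨a, ha, rfl⟩
    refine ⟨a⁻¹, inv_mem ha, ?_⟩
    have hac : x * a * x⁻¹ ∈ A := ‹A.Normal›.conj_mem _ ha x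
    calc _ = (x * a * x⁻¹) * a⁻¹ := by group
      _ = _ := by rw [hA _ hac _ (inv_mem ha)]; group

lemma commutatorSubgroup_normal (A : Subgroup G) [A.Normal]
    (hA : ∀ a ∈ A, ∀ b ∈ A, a * b = b * a) (hcomm : ∀ x y : G, x * y * x⁻¹ * y⁻¹ ∈ A) (x : G) :
    (commutatorSubgroup A hA x).Normal := by
  refine ⟨?_⟩
  rintro _ ⟨a, ha, rfl⟩ g
  have hag : g * a * g⁻¹ ∈ A := ‹A.Normal›.conj_mem _ ha g
  refine ⟨_, hag, ?_⟩
  have hα := hcomm g x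
  set α := g * x * g⁻¹ * x⁻¹ with hαdef
  set b := g * a * g⁻¹ with hb
  have hxg : g * x * g⁻¹ = α * x := by rw [hαdef]; group
  have hbx : b * (x * b⁻¹ * x⁻¹) ∈ A :=
    mul_mem hag (‹A.Normal›.conj_mem _ (inv_mem hag) x)
  calc _ = b * (g * x * g⁻¹) * b⁻¹ * (g * x * g⁻¹)⁻¹ := by rw [hb]; group
    _ = (b * α) * (x * b⁻¹ * x⁻¹) * α⁻¹ := by rw [hxg]; group
    _ = α * (b * (x * b⁻¹ * x⁻¹)) * α⁻¹ := by rw [hA _ hag _ hα]; group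
    _ = _ := by rw [hA _ hα _ hbx]; group

lemma commute_of_quadratic [Fact p.Prime] [Finite G] (hodd : Odd p) (hG : IsPGroup p G)
    (hρ : Function.Injective ρ)
    (hnoquad : ∀ g ∈ Subgroup.center G, g ^ p = 1 → ¬ IsQuadElt p ρ g)
    (A : Subgroup G) [A.Normal] (hA : ∀ a ∈ A, ∀ b ∈ A, a * b = b * a)
    (hcomm : ∀ x y : G, x * y * x⁻¹ * y⁻¹ ∈ A) {x : G} (hx : (ρ x - 1) ^ 2 = 0) :
    ∀ a ∈ A, a * x = x * a := by
  by_contra! h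
  obtain ⟨a, ha, hax⟩ := h
  have := commutatorSubgroup_normal A hA hcomm x
  obtain ⟨z, ⟨b, -, hzb⟩, hz, hz1⟩ := Subgroup.exists_mem_center_of_normal hG
    (commutatorSubgroup A hA x) fun hbot => hax <| by
      have : a * x * a⁻¹ * x⁻¹ ∈ commutatorSubgroup A hA x := ⟨a, ha, rfl⟩
      rwa [hbot, Subgroup.mem_bot, mul_inv_eq_one, mul_inv_eq_iff_eq_mul] at this
  have hq := quadratic_of_central_commutator hodd hx hz hzb
  exact hnoquad z hz (pow_eq_one_of_quadratic hρ hq) ⟨hz1, hq⟩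

lemma quadratic_of_fixes_commutators {g : G} (h : ∀ v, ρ g (ρ g v - v) = ρ g v - v) :
    (ρ g - 1) ^ 2 = 0 := by
  ext v
  simpa [sq, sub_eq_zero] using h v

lemma map_conj_mem_maximizers [Finite V] {B T : Subgroup G} [B.Normal]
    (hT : T ∈ maximizers ρ B) (g : G) :
    T.map (MulAut.conj g).toMonoidHom ∈ maximizers ρ B := by
  refine ⟨?_, fun K hK => (hT.2 K hK).trans (fixMeasure_le_map_conj ρ g T)⟩
  rintro _ ⟨t, ht, rfl⟩
  exact ‹B.Normal›.conj_mem _ (hT.1 ht) g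

/-- An abelian normal subgroup contains no subgroup `H ≠ 1` with `|H|·|C_V(H)| ≥ |V|`. -/
lemma fixMeasure_lt_of_le_abelian_normal [Fact p.Prime] [Finite G] [Finite V]
    (hG : IsPGroup p G) (hρ : Function.Injective ρ)
    (hnoquad : ∀ g ∈ Subgroup.center G, g ^ p = 1 → ¬ IsQuadElt p ρ g)
    {B H : Subgroup G} [B.Normal] (hB : ∀ a ∈ B, ∀ b ∈ B, a * b = b * a)
    (hHB : H ≤ B) (hH : H ≠ ⊥) : fixMeasure ρ H < Nat.card V := by
  by_contra! hVH
  obtain ⟨T, hT, F, -, hF, hFT, hq⟩ := exists_quadratic_maximizer hG hρ hB hHB hH hVH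
  have hTn : T.Normal := ⟨fun t ht g => hT.2 (map_conj_mem_maximizers hT.1 g) ⟨t, ht, rfl⟩⟩
  set N := pointwiseFixer ρ T {w | ∃ s ∈ T, ∃ v, w = ρ s v - v} with hN
  have hNn : N.Normal := by
    refine ⟨fun t ht g => ⟨hTn.conj_mem t ht.1 g, ?_⟩⟩
    rintro _ ⟨s, hs, v, rfl⟩
    have hgs := ht.2 _ ⟨_, hTn.conj_mem s hs g⁻¹, ρ g⁻¹ v, rfl⟩
    simpa using congrArg (ρ g) hgs
  have hFN : F ≤ N := fun f hf => ⟨hFT hf, by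
    rintro _ ⟨s, hs, v, rfl⟩
    exact hq f hf s hs v⟩
  obtain ⟨z, hzN, hz, hz1⟩ := Subgroup.exists_mem_center_of_normal hG N
    fun h => hF (le_bot_iff.1 (h ▸ hFN))
  have hzq : (ρ z - 1) ^ 2 = 0 :=
    quadratic_of_fixes_commutators fun v => hzN.2 _ ⟨z, hzN.1, v, rfl⟩
  exact hnoquad z hz (pow_eq_one_of_quadratic hρ hzq) ⟨hz1, hzq⟩

end QuadraticElements

/-- **Corollary (abelian-by-abelian case).** Let `p` be an odd prime, `G` a finite `p`-group
and `V` a faithful `𝔽_p G`-module such that no non-identity element of `Ω₁(Z(G))` is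
quadratic on `V`.  If `G` has an abelian normal subgroup `A ⊴ G` with `G/A` abelian,
then `V` is not an `F`-module. -/
theorem stmt2 {p : ℕ} (hp : p.Prime) (hodd : Odd p) {G V : Type*} [Group G] [Finite G]
    [AddCommGroup V] [Module (ZMod p) V] [Finite V]
    (hG : IsPGroup p G) (ρ : Representation (ZMod p) G V)
    (hfaithful : Function.Injective ρ)
    (hnoquad : ∀ g ∈ Subgroup.center G, g ^ p = 1 → ¬ IsQuadElt p ρ g)
    (A : Subgroup G) [A.Normal]
    (hAab : ∀ a ∈ A, ∀ b ∈ A, a * b = b * a)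
    (hQab : ∀ x y : G ⧸ A, x * y = y * x) :
    ¬ ∃ E : Subgroup G, IsOffender p ρ E := by
  rintro ⟨E, hE, ⟨-, hEab⟩, hEV⟩
  have := Fact.mk hp
  have hcomm : ∀ x y : G, x * y * x⁻¹ * y⁻¹ ∈ A := fun x y => by
    rw [← QuotientGroup.eq_one_iff, QuotientGroup.mk_mul, QuotientGroup.mk_mul,
      QuotientGroup.mk_mul, hQab x y]
    simp
  obtain ⟨T, -, F, hFmax, hF, hFT, hq⟩ :=
    exists_quadratic_maximizer hG hfaithful hEab le_rfl hE hEV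
  have hFA : ∀ f ∈ F, ∀ a ∈ A, a * f = f * a := fun f hf =>
    commute_of_quadratic hodd hG hfaithful hnoquad A hAab hcomm
      (quadratic_of_fixes_commutators (hq f hf f (hFT hf)))
  have hab : F ⊔ A ≤ Subgroup.centralizer (F ⊔ A : Subgroup G) := by
    have hFc : F ≤ Subgroup.centralizer (F ⊔ A : Subgroup G) := Subgroup.le_centralizer_iff.1 <|
      sup_le (fun x hx => Subgroup.mem_centralizer_iff.2 fun y hy =>
        hEab y (hFmax.1 hy) x (hFmax.1 hx))
        (fun x hx => Subgroup.mem_centralizer_iff.2 fun y hy => (hFA y hy x hx).symm)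
    have hAc : A ≤ Subgroup.centralizer (F ⊔ A : Subgroup G) := Subgroup.le_centralizer_iff.1 <|
      sup_le (fun x hx => Subgroup.mem_centralizer_iff.2 fun y hy => hFA x hx y hy)
        (fun x hx => Subgroup.mem_centralizer_iff.2 fun y hy => hAab y hy x hx)
    exact sup_le hFc hAc
  have hnormal : (F ⊔ A).Normal := ⟨fun b hb g => by
    rw [← inv_mul_cancel_right (g * b * g⁻¹) b]
    exact mul_mem (Subgroup.mem_sup_right (hcomm g b)) hb⟩
  exact (fixMeasure_lt_of_le_abelian_normal hG hfaithful hnoquad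
    (fun a ha b hb => Subgroup.mem_centralizer_iff.1 (hab hb) a ha)
    le_sup_left hF).not_ge (hEV.trans (hFmax.2 E le_rfl))
end

section
/- Let p be a prime, G a finite p-group, and V a faithful 𝔽_p G-module. If E belongs to 𝒫(G,V), then there exists a subgroup F ≤ E with F ∈ 𝒫(G,V), F quadratic on V (i.e. [V,F,F] = 0), and j_F(V) = j_E(V). -/
open Polynomial

section Replacement

variable {p : ℕ} {G V : Type*} [Group G] [AddCommGroup V] [Module (ZMod p) V]

theorem mem_fixedPts {ρ : Representation (ZMod p) G V} {H : Subgroup G} {v : V} :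
    v ∈ fixedPts p ρ H ↔ ∀ h ∈ H, ρ h v = v :=
  Iff.rfl

/-- The centralizer `C_H([v,H])` of the commutators `ρ a v - v`, `a ∈ H`. -/
def commutatorCentralizer (ρ : Representation (ZMod p) G V) (H : Subgroup G) (v : V) :
    Subgroup G where
  carrier := {f | f ∈ H ∧ ∀ a ∈ H, ρ f (ρ a v - v) = ρ a v - v}
  one_mem' := ⟨H.one_mem, fun a _ => by simp⟩
  mul_mem' := by
    rintro f g ⟨hf, hf'⟩ ⟨hg, hg'⟩
    refine ⟨H.mul_mem hf hg, fun a ha => ?_⟩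
    rw [map_mul, Module.End.mul_apply, hg' a ha, hf' a ha]
  inv_mem' := by
    rintro f ⟨hf, hf'⟩
    refine ⟨H.inv_mem hf, fun a ha => ?_⟩
    conv_lhs => rw [← hf' a ha]
    exact ρ.inv_self_apply f _

theorem commutatorCentralizer_le (ρ : Representation (ZMod p) G V) (H : Subgroup G) (v : V) :
    commutatorCentralizer ρ H v ≤ H :=
  fun _ hf => hf.1

theorem fixedPts_anti (ρ : Representation (ZMod p) G V) {H K : Subgroup G} (h : H ≤ K) :
    fixedPts p ρ K ≤ fixedPts p ρ H :=
  fun _ hv g hg => hv g (h hg)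

theorem fixedPts_bot (ρ : Representation (ZMod p) G V) : fixedPts p ρ (⊥ : Subgroup G) = ⊤ := by
  ext v
  simp [mem_fixedPts]

/-- The map `(a, c) ↦ (ρ a v - v) + c` from `H × C_V(H)` to `C_V(C_H([v,H]))`. -/
def commutatorAdd (ρ : Representation (ZMod p) G V) (H : Subgroup G) (v : V)
    (x : H × fixedPts p ρ H) : fixedPts p ρ (commutatorCentralizer ρ H v) :=
  ⟨ρ x.1 v - v + x.2, add_mem (fun _ hf => hf.2 _ x.1.2)
    (fixedPts_anti ρ (commutatorCentralizer_le ρ H v) x.2.2)⟩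

theorem mul_inv_mem_commutatorCentralizer (ρ : Representation (ZMod p) G V) {H : Subgroup G}
    (hH : ∀ x ∈ H, ∀ y ∈ H, x * y = y * x) {v : V} {x y : H × fixedPts p ρ H}
    (h : commutatorAdd ρ H v x = commutatorAdd ρ H v y) :
    (x.1 * (y.1 : G)⁻¹ : G) ∈ commutatorCentralizer ρ H v := by
  obtain ⟨⟨a, ha⟩, ⟨c, hc⟩⟩ := x
  obtain ⟨⟨b, hb⟩, ⟨d, hd⟩⟩ := y
  have h' : ρ a v - v + c = ρ b v - v + d := congrArg Subtype.val h
  have hbi := H.inv_mem hb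
  have key : ρ (a * b⁻¹) v = v + (d - c) := by
    have e : ρ a v = ρ b v + (d - c) :=
      calc ρ a v = (ρ a v - v + c) + v - c := by abel
        _ = ρ b v + (d - c) := by rw [h']; abel
    rw [hH a ha _ hbi, map_mul, Module.End.mul_apply, e, map_add, ρ.inv_self_apply,
      (sub_mem hd hc : d - c ∈ fixedPts p ρ H) _ hbi]
  refine ⟨H.mul_mem ha hbi, fun g hg => ?_⟩
  have e2 : ρ (a * b⁻¹) (ρ g v) = ρ g v + (d - c) := by
    rw [← Module.End.mul_apply, ← map_mul, hH _ (H.mul_mem ha hbi) g hg, map_mul,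
      Module.End.mul_apply, key, map_add, (sub_mem hd hc : d - c ∈ fixedPts p ρ H) g hg]
  change ρ (a * b⁻¹) (ρ g v - v) = ρ g v - v
  rw [map_sub, e2, key]
  abel

theorem eq_of_commutatorAdd_eq_of_fst_eq {ρ : Representation (ZMod p) G V} {H : Subgroup G} {v : V}
    {x y : H × fixedPts p ρ H} (h : commutatorAdd ρ H v x = commutatorAdd ρ H v y)
    (h₁ : x.1 = y.1) : x = y := by
  refine Prod.ext h₁ (Subtype.ext ?_)
  have h' : ρ x.1 v - v + (x.2 : V) = ρ y.1 v - v + y.2 := congrArg Subtype.val h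
  rw [h₁] at h'
  exact add_left_cancel h'

/-- If `a` has order dividing `p` and fixes `(2 - a) v`, then `a` fixes `v`. -/
theorem eq_of_sub_fixed (hp : p.Prime) (ρ : Representation (ZMod p) G V) {a : G}
    (ha : a ^ p = 1) {v c : V} (hc : ρ a c = c) (hv : v = ρ a v - v + c) : v = c := by
  have : Fact p.Prime := ⟨hp⟩
  set N : Module.End (ZMod p) V := ρ a - 1 with hN
  have hNp : N ^ p = 0 := by
    have : CharP (Module.End (ZMod p) V) p ∨ Subsingleton (Module.End (ZMod p) V) := by
      rcases subsingleton_or_nontrivial (Module.End (ZMod p) V) with h | h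
      · exact Or.inr h
      · exact Or.inl (charP_of_injective_algebraMap
          (algebraMap (ZMod p) (Module.End (ZMod p) V)).injective p)
    rcases this with h | h
    · rw [hN, sub_pow_char_of_commute p (Commute.one_right _), ← map_pow, ha, map_one, one_pow,
        sub_self]
    · exact Subsingleton.elim _ _
  have hNv : N v = ρ a v - v := by simp [hN]
  have hNc : N c = 0 := by simp [hN, hc]
  have hNN : N (N v) = N v := by
    conv_rhs => rw [hv, map_add, hNc, add_zero, ← hNv]
  have hpow (n : ℕ) : (N ^ n) (N v) = N v := by
    induction n with
    | zero => simp
    | succ n ih => rw [pow_succ, Module.End.mul_apply, hNN, ih]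
  have h0 := hpow p
  rw [hNp, LinearMap.zero_apply, hNv] at h0
  rw [hv, ← h0, zero_add]

variable [Finite V]

theorem jval_le_jval_iff (ρ : Representation (ZMod p) G V) (H K : Subgroup G) :
    jval p ρ H ≤ jval p ρ K ↔ Nat.card H * Nat.card (fixedPts p ρ H) ≤
      Nat.card K * Nat.card (fixedPts p ρ K) := by
  rw [jval, jval, div_le_div_iff_of_pos_right (Nat.cast_pos.2 Nat.card_pos)]
  norm_cast

/-- If `H` is nontrivial elementary abelian and `j_H(V) ≥ j_1(V)`, then no centralizer
`C_H([v,H])` is trivial. -/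
theorem commutatorCentralizer_ne_bot (hp : p.Prime) (ρ : Representation (ZMod p) G V)
    {H : Subgroup G} (hH : IsElemAbelian p H) (hne : H ≠ ⊥) (hj : jval p ρ ⊥ ≤ jval p ρ H)
    (v : V) : commutatorCentralizer ρ H v ≠ ⊥ := by
  intro hbot
  have hinj : Function.Injective (commutatorAdd ρ H v) := fun x y h => by
    have hm := mul_inv_mem_commutatorCentralizer ρ hH.2 h
    rw [hbot, Subgroup.mem_bot, mul_inv_eq_one] at hm
    exact eq_of_commutatorAdd_eq_of_fst_eq h (Subtype.ext hm)
  have hcard : Nat.card (fixedPts p ρ (commutatorCentralizer ρ H v)) ≤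
      Nat.card (H × fixedPts p ρ H) := by
    rw [hbot, Nat.card_prod]
    simpa using (jval_le_jval_iff ρ _ _).1 hj
  have hsurj := (hinj.bijective_of_nat_card_le hcard).2
  have hv : v ∈ fixedPts p ρ (commutatorCentralizer ρ H v) := by
    rw [hbot, fixedPts_bot]
    trivial
  obtain ⟨⟨⟨a, ha⟩, ⟨c, hc⟩⟩, hac⟩ := hsurj ⟨v, hv⟩
  have hvc : v = c := eq_of_sub_fixed hp ρ (hH.1 a ha) (hc a ha) (congrArg Subtype.val hac).symm
  refine hne (le_bot_iff.mp fun f hf => ?_)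
  rw [← hbot]
  refine ⟨hf, fun b hb => ?_⟩
  rw [hvc, hc b hb, sub_self, map_zero]

variable [Finite G]

/-- Thompson's counting argument: passing to `C_H([v,H])` does not decrease `|H| |C_V(H)|`. -/
theorem card_mul_card_fixedPts_le (ρ : Representation (ZMod p) G V) {H : Subgroup G}
    (hH : ∀ x ∈ H, ∀ y ∈ H, x * y = y * x) (v : V) :
    Nat.card H * Nat.card (fixedPts p ρ H) ≤ Nat.card (commutatorCentralizer ρ H v) *
      Nat.card (fixedPts p ρ (commutatorCentralizer ρ H v)) := by
  rw [← Nat.card_prod, ← Nat.card_prod]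
  let φ := commutatorAdd ρ H v
  have hφ (x) : φ x = φ (Function.invFun φ (φ x)) := (Function.invFun_eq ⟨x, rfl⟩).symm
  refine Nat.card_le_card_of_injective
    (fun x => (⟨x.1 * ((Function.invFun φ (φ x)).1 : G)⁻¹,
      mul_inv_mem_commutatorCentralizer ρ hH (hφ x)⟩, φ x)) fun x y hxy => ?_
  obtain ⟨h₁, h₂⟩ := Prod.ext_iff.mp hxy
  refine eq_of_commutatorAdd_eq_of_fst_eq h₂ (Subtype.ext ?_)
  have h₁' := congrArg Subtype.val h₁
  simp only at h₁' h₂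
  rw [h₂] at h₁'
  exact mul_right_cancel h₁'

theorem jval_le_jval_commutatorCentralizer (ρ : Representation (ZMod p) G V) {H : Subgroup G}
    (hH : ∀ x ∈ H, ∀ y ∈ H, x * y = y * x) (v : V) :
    jval p ρ H ≤ jval p ρ (commutatorCentralizer ρ H v) :=
  (jval_le_jval_iff ρ _ _).2 (card_mul_card_fixedPts_le ρ hH v)

end Replacement

/-- **Lemma (Timmesfeld replacement).** Let `p` be a prime, `G` a finite `p`-group and `V`
a faithful `𝔽_p G`-module.  If `E ∈ 𝒫(G,V)` (the set of best offenders), then there is a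
subgroup `F ≤ E` with `F ∈ 𝒫(G,V)`, `F` quadratic on `V`, and `j_F(V) = j_E(V)`. -/
theorem stmt8 {p : ℕ} (hp : p.Prime) {G V : Type*} [Group G] [Finite G]
    [AddCommGroup V] [Module (ZMod p) V] [Finite V]
    (hG : IsPGroup p G) (ρ : Representation (ZMod p) G V)
    (hfaithful : Function.Injective ρ)
    (E : Subgroup G) (hE : E ∈ bestOffenders p ρ) :
    ∃ F : Subgroup G, F ≤ E ∧ F ∈ bestOffenders p ρ ∧ IsQuadSubgroup p ρ F ∧
      jval p ρ F = jval p ρ E := by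
  have hsub {F : Subgroup G} (hF : F ≤ E) : IsElemAbelian p F :=
    ⟨fun x hx => hE.2.1.1 x (hF hx), fun x hx y hy => hE.2.1.2 x (hF hx) y (hF hy)⟩
  obtain ⟨F, ⟨hFE, hFne, hFj⟩, hmin⟩ := Set.Finite.exists_minimal
    (Set.toFinite {F : Subgroup G | F ≤ E ∧ F ≠ ⊥ ∧ jval p ρ F = jval p ρ E})
    ⟨E, le_rfl, hE.1, rfl⟩
  have hFle {K : Subgroup G} (hK : K ≤ F) : jval p ρ K ≤ jval p ρ F :=
    hFj ▸ hE.2.2 K (hK.trans hFE)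
  refine ⟨F, hFE, ⟨hFne, hsub hFE, fun K hK => hFle hK⟩, fun e he f hf => ?_, hFj⟩
  ext v
  have hle := commutatorCentralizer_le ρ F v
  have hj := (hFle hle).antisymm (jval_le_jval_commutatorCentralizer ρ (hsub hFE).2 v)
  have he' := hmin ⟨hle.trans hFE,
    commutatorCentralizer_ne_bot hp ρ (hsub hFE) hFne (hFle bot_le) v, hj.trans hFj⟩ hle he
  have hfix := he'.2 f hf
  simpa [sub_eq_zero] using hfix
end
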